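/- arXiv:2006.04659 — 3 statements merged into one kernel-verified Lean document; each statement's English description precedes it below -/
import Mathlib

section
/- Factorization in the Mellin space (symmetric model): let P : (0,∞) → [0,∞) be a measurable payoff function, and suppose its payoff Mellin transform P*(s) := ∫_ℝ P(S_t e^{(r−q+ω)τ + x}) |x−μτ|^{−s} dx converges absolutely for Re(s) ∈ (c₋, c₊) with (c₋, c₊) ∩ (0,∞) nonempty. Fix c₁ ∈ (c₋, c₊) ∩ (0,∞) and assume the function (x,u) ↦ P(S_t e^{(r−q+ω)τ+x}) |Γ((c₁+iu)/2) K_{1−(c₁+iu)/2}(αδτ) (2δτ/α)^{(c₁+iu)/2}| · |x−μτ|^{−c₁} is integrable on ℝ². Then the option price C := e^{−rτ} ∫_ℝ P(S_t e^{(r−q+ω)τ + x}) f(x,τ) dx satisfies C = (α/(2π)) e^{(αδ−r)τ} · (1/(2π)) ∫_ℝ Γ((c₁+iu)/2) P*(c₁+iu) K_{1−(c₁+iu)/2}(αδτ) (2δτ/α)^{(c₁+iu)/2} du. -/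
open MeasureTheory

/-- Modified Bessel function of the second kind, real index `ν`, real argument `z`. -/
noncomputable def besselKr (ν : ℝ) (z : ℝ) : ℝ :=
  (1 / 2) * (z / 2) ^ ν *
    ∫ t in Set.Ioi (0 : ℝ), Real.exp (-t - z ^ 2 / (4 * t)) * t ^ (-ν - 1)

/-- Symmetric NIG density at time `t`. -/
noncomputable def nigDensity (α δ μ x t : ℝ) : ℝ :=
  (α * δ * t / Real.pi) * Real.exp (α * δ * t) *
    besselKr 1 (α * Real.sqrt ((δ * t) ^ 2 + (x - μ * t) ^ 2)) /
    Real.sqrt ((δ * t) ^ 2 + (x - μ * t) ^ 2)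

/-- Modified Bessel function of the second kind, complex index `ν`, real argument `z`. -/
noncomputable def besselK (ν : ℂ) (z : ℝ) : ℂ :=
  (1 / 2) * ((z : ℂ) / 2) ^ ν *
    ∫ t in Set.Ioi (0 : ℝ), Complex.exp (-(t : ℂ) - (z : ℂ) ^ 2 / (4 * (t : ℂ))) *
      (t : ℂ) ^ (-ν - 1)


/-- Integrability of the Bessel kernel. -/
lemma kernel_integrable (b a : ℝ) (hb : 0 < b) :
    IntegrableOn (fun t : ℝ => Real.exp (-t - b / t) * t ^ a) (Set.Ioi 0) := by
  obtain ⟨n, hn⟩ := exists_nat_gt (-a)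
  have h1 := (Real.GammaIntegral_convergent (s := a + n + 1) (by linarith)).const_mul
    ((n.factorial : ℝ) / b ^ n)
  refine Integrable.mono' h1 (by fun_prop) ?_
  filter_upwards [ae_restrict_mem measurableSet_Ioi] with t ht
  have ht : 0 < t := ht
  have h2 := Real.pow_div_factorial_le_exp (x := b / t) (by positivity) n
  rw [Real.norm_of_nonneg (by positivity), sub_eq_add_neg, Real.exp_add, Real.exp_neg (b / t)]
  have h3 : (Real.exp (b / t))⁻¹ ≤ (n.factorial : ℝ) / b ^ n * t ^ n := by
    rw [inv_le_comm₀ (by positivity) (by positivity)]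
    refine le_trans (le_of_eq ?_) h2
    rw [div_pow]
    field_simp
  have h4 : t ^ (a + n + 1 - 1) = t ^ a * t ^ n := by
    rw [add_sub_cancel_right, Real.rpow_add ht, Real.rpow_natCast]
  rw [h4]
  calc _ ≤ Real.exp (-t) * ((n.factorial : ℝ) / b ^ n * t ^ n) * t ^ a := by gcongr
    _ = _ := by ring

/-- The Mellin transform of a Gaussian. -/
lemma mellin_gauss (s : ℂ) (hs : 0 < s.re) (a : ℝ) (ha : 0 < a) :
    ∫ y in Set.Ioi (0 : ℝ), (y : ℂ) ^ (s - 1) * (Real.exp (-a * y ^ 2) : ℂ)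
      = (1 / 2) * (a : ℂ) ^ (-(s / 2)) * Complex.Gamma (s / 2) := by
  have hs2 : 0 < (s / 2).re := by simpa using hs
  have h1 := mellin_comp_rpow (fun y : ℝ => (Real.exp (-(a * y)) : ℂ)) s 2
  have h2 := mellin_comp_mul_left (fun y : ℝ => (Real.exp (-y) : ℂ)) (s / 2) ha
  rw [← Complex.GammaIntegral_eq_mellin, ← Complex.Gamma_eq_integral hs2] at h2
  simp only [Complex.ofReal_ofNat] at h1
  rw [h2] at h1
  simp only [mellin, smul_eq_mul, Complex.real_smul] at h1
  calc _ = _ := by simp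
    _ = _ := h1
    _ = _ := by simp; ring

/-- Auxiliary radial function `K₁(α √(k²+y²)) / √(k²+y²)`. -/
noncomputable def radialG (α k y : ℝ) : ℝ :=
  (α / 4) * ∫ t in Set.Ioi (0 : ℝ),
    Real.exp (-(α ^ 2 / (4 * t)) * y ^ 2) * (Real.exp (-t - (α ^ 2 * k ^ 2 / 4) / t) * t ^ (-2 : ℝ))

lemma nigDensity_eq (α δ μ x τ : ℝ) (hα : 0 < α) (hδ : 0 < δ) (hτ : 0 < τ) :
    nigDensity α δ μ x τ = (α * (δ * τ) / Real.pi) * Real.exp (α * (δ * τ)) *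
      radialG α (δ * τ) |x - μ * τ| := by
  unfold nigDensity radialG besselKr
  have hk : 0 < δ * τ := by positivity
  have hR : 0 < Real.sqrt ((δ * τ) ^ 2 + (x - μ * τ) ^ 2) := by positivity
  have hsq : Real.sqrt ((δ * τ) ^ 2 + (x - μ * τ) ^ 2) ^ 2 = (δ * τ) ^ 2 + (x - μ * τ) ^ 2 :=
    Real.sq_sqrt (by positivity)
  have : ∫ t in Set.Ioi (0 : ℝ), Real.exp (-t -
      (α * Real.sqrt ((δ * τ) ^ 2 + (x - μ * τ) ^ 2)) ^ 2 / (4 * t)) * t ^ (-1 - 1 : ℝ)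
      = ∫ t in Set.Ioi (0 : ℝ),
    Real.exp (-(α ^ 2 / (4 * t)) * |x - μ * τ| ^ 2) *
      (Real.exp (-t - (α ^ 2 * (δ * τ) ^ 2 / 4) / t) * t ^ (-2 : ℝ)) := by
    refine setIntegral_congr_fun measurableSet_Ioi fun t ht => ?_
    have ht : 0 < t := ht
    rw [← mul_assoc, ← Real.exp_add, mul_pow, hsq, sq_abs]
    congr 2
    · field_simp
      ring
    · norm_num
  rw [this, Real.rpow_one]
  field_simp
  ring

lemma radialG_continuous (α k : ℝ) (hα : 0 < α) (hk : 0 < k) :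
    Continuous (radialG α k) := by
  unfold radialG
  refine continuous_const.mul ?_
  refine continuous_of_dominated (fun y => by fun_prop) (fun y => ?_)
    (kernel_integrable (α ^ 2 * k ^ 2 / 4) (-2) (by positivity))
    (ae_of_all _ fun t => by fun_prop)
  filter_upwards [ae_restrict_mem measurableSet_Ioi] with t ht
  have ht : 0 < t := ht
  rw [Real.norm_of_nonneg (by positivity)]
  refine mul_le_of_le_one_left (by positivity) ?_
  rw [Real.exp_le_one_iff, neg_mul, neg_nonpos]
  positivity

lemma radial_prod_integrable (α k : ℝ) (hα : 0 < α) (hk : 0 < k) (s : ℂ) (hs : 0 < s.re) :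
    Integrable (Function.uncurry fun (y t : ℝ) => (y : ℂ) ^ (s - 1) *
      ((Real.exp (-(α ^ 2 / (4 * t)) * y ^ 2) *
        (Real.exp (-t - (α ^ 2 * k ^ 2 / 4) / t) * t ^ (-2 : ℝ)) : ℝ) : ℂ))
      ((volume.restrict (Set.Ioi 0)).prod (volume.restrict (Set.Ioi 0))) := by
  have hm : Measurable (Function.uncurry fun (y t : ℝ) => (y : ℂ) ^ (s - 1) *
      ((Real.exp (-(α ^ 2 / (4 * t)) * y ^ 2) *
        (Real.exp (-t - (α ^ 2 * k ^ 2 / 4) / t) * t ^ (-2 : ℝ)) : ℝ) : ℂ)) := by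
    unfold Function.uncurry
    fun_prop
  have hnorm : ∀ y : ℝ, 0 < y → ∀ t : ℝ, 0 < t →
      ‖(y : ℂ) ^ (s - 1) * ((Real.exp (-(α ^ 2 / (4 * t)) * y ^ 2) *
        (Real.exp (-t - (α ^ 2 * k ^ 2 / 4) / t) * t ^ (-2 : ℝ)) : ℝ) : ℂ)‖ =
      (y ^ (s.re - 1) * Real.exp (-(α ^ 2 / (4 * t)) * y ^ 2)) *
        (Real.exp (-t - (α ^ 2 * k ^ 2 / 4) / t) * t ^ (-2 : ℝ)) := by
    intro y hy t ht
    rw [norm_mul, Complex.norm_cpow_eq_rpow_re_of_pos hy, Complex.norm_real,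
      Real.norm_of_nonneg (by positivity)]
    simp [mul_assoc]
  rw [integrable_prod_iff' hm.aestronglyMeasurable]
  constructor
  · filter_upwards [ae_restrict_mem measurableSet_Ioi] with t ht
    have ht : 0 < t := ht
    refine Integrable.mono' ((integrableOn_rpow_mul_exp_neg_mul_sq (b := α ^ 2 / (4 * t))
      (by positivity) (s := s.re - 1) (by linarith)).mul_const
      (Real.exp (-t - (α ^ 2 * k ^ 2 / 4) / t) * t ^ (-2 : ℝ))) ?_ ?_
    · exact (hm.comp measurable_prodMk_right).aestronglyMeasurable
    · filter_upwards [ae_restrict_mem measurableSet_Ioi] with y hy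
      exact (hnorm y hy t ht).le
  · have hI := ((kernel_integrable (α ^ 2 * k ^ 2 / 4) (s.re / 2 - 2) (by positivity)).const_mul
      ((α ^ 2 / 4) ^ (-(s.re / 2)) * (1 / 2) * Real.Gamma (s.re / 2)))
    refine hI.congr ?_
    filter_upwards [ae_restrict_mem measurableSet_Ioi] with t ht
    have ht : 0 < t := ht
    have e1 : ∫ y in Set.Ioi (0 : ℝ), ‖Function.uncurry (fun (y t : ℝ) => (y : ℂ) ^ (s - 1) *
      ((Real.exp (-(α ^ 2 / (4 * t)) * y ^ 2) *
        (Real.exp (-t - (α ^ 2 * k ^ 2 / 4) / t) * t ^ (-2 : ℝ)) : ℝ) : ℂ)) (y, t)‖ =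
      ∫ y in Set.Ioi (0 : ℝ), (y ^ (s.re - 1) * Real.exp (-(α ^ 2 / (4 * t)) * y ^ (2 : ℝ))) *
        (Real.exp (-t - (α ^ 2 * k ^ 2 / 4) / t) * t ^ (-2 : ℝ)) := by
      refine setIntegral_congr_fun measurableSet_Ioi fun y hy => ?_
      simp only [Real.rpow_two]
      exact hnorm y hy t ht
    rw [e1, integral_mul_const, integral_rpow_mul_exp_neg_mul_rpow (by norm_num) (by linarith)
      (by positivity)]
    have e2 : α ^ 2 / (4 * t) = α ^ 2 / 4 * t⁻¹ := by field_simp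
    have e3 : t ^ (s.re / 2 - 2) = t ^ (s.re / 2) * t ^ (-2 : ℝ) := by
      rw [← Real.rpow_add ht]; ring_nf
    rw [e2, Real.mul_rpow (by positivity) (by positivity), Real.inv_rpow ht.le,
      e3, sub_add_cancel, neg_div, Real.rpow_neg ht.le (s.re / 2), inv_inv]
    ring

lemma radialG_cast (α k y : ℝ) (s : ℂ) : (y : ℂ) ^ (s - 1) • (radialG α k y : ℂ) =
    (α / 4 : ℂ) * ∫ t in Set.Ioi (0 : ℝ), (y : ℂ) ^ (s - 1) *
      ((Real.exp (-(α ^ 2 / (4 * t)) * y ^ 2) *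
        (Real.exp (-t - (α ^ 2 * k ^ 2 / 4) / t) * t ^ (-2 : ℝ)) : ℝ) : ℂ) := by
  rw [integral_const_mul, integral_complex_ofReal, radialG, smul_eq_mul]
  push_cast
  ring

lemma radialG_mellinConvergent (α k : ℝ) (hα : 0 < α) (hk : 0 < k) (s : ℂ) (hs : 0 < s.re) :
    MellinConvergent (fun y => (radialG α k y : ℂ)) s := by
  unfold MellinConvergent
  simp_rw [radialG_cast]
  exact (radial_prod_integrable α k hα hk s hs).integral_prod_left.const_mul _

lemma radialG_mellin (α k : ℝ) (hα : 0 < α) (hk : 0 < k) (s : ℂ) (hs : 0 < s.re) :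
    Complex.Gamma (s / 2) * besselK (1 - s / 2) (α * k) * ((2 * k / α : ℝ) : ℂ) ^ (s / 2)
      = (2 * k : ℂ) * mellin (fun y => (radialG α k y : ℂ)) s := by
  unfold mellin
  simp_rw [radialG_cast]
  rw [integral_const_mul, integral_integral_swap (radial_prod_integrable α k hα hk s hs)]
  have hα' : (α : ℂ) ≠ 0 := by exact_mod_cast hα.ne'
  have hk' : (k : ℂ) ≠ 0 := by exact_mod_cast hk.ne'
  have e1 : ∀ t ∈ Set.Ioi (0 : ℝ), (∫ y in Set.Ioi (0 : ℝ), (y : ℂ) ^ (s - 1) *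
      ((Real.exp (-(α ^ 2 / (4 * t)) * y ^ 2) *
        (Real.exp (-t - (α ^ 2 * k ^ 2 / 4) / t) * t ^ (-2 : ℝ)) : ℝ) : ℂ)) =
      ((1 / 2) * ((α ^ 2 / 4 : ℝ) : ℂ) ^ (-(s / 2)) * Complex.Gamma (s / 2)) *
      (Complex.exp (-(t : ℂ) - ((α * k : ℝ) : ℂ) ^ 2 / (4 * (t : ℂ))) *
        (t : ℂ) ^ (-(1 - s / 2) - 1)) := by
    intro t ht
    have ht : 0 < t := ht
    have ht' : (t : ℂ) ≠ 0 := by exact_mod_cast ht.ne'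
    have := mellin_gauss s hs (α ^ 2 / (4 * t)) (by positivity)
    have e2 : α ^ 2 / (4 * t) = α ^ 2 / 4 * t⁻¹ := by field_simp
    have e3 : (t : ℂ) ^ (-(1 - s / 2) - 1) = (t : ℂ) ^ (s / 2) * (t : ℂ) ^ (-2 : ℂ) := by
      rw [← Complex.cpow_add _ _ ht']; ring_nf
    have e4 : ((t⁻¹ : ℝ) : ℂ) ^ (-(s / 2)) = (t : ℂ) ^ (s / 2) := by
      rw [Complex.ofReal_inv, Complex.inv_cpow _ _ (by
        rw [Complex.arg_ofReal_of_nonneg ht.le]; exact Real.pi_pos.ne), Complex.cpow_neg, inv_inv]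
    have e5 : ((Real.exp (-t - (α ^ 2 * k ^ 2 / 4) / t) * t ^ (-2 : ℝ) : ℝ) : ℂ) =
        Complex.exp (-(t : ℂ) - ((α * k : ℝ) : ℂ) ^ 2 / (4 * (t : ℂ))) * (t : ℂ) ^ (-2 : ℂ) := by
      rw [Complex.ofReal_mul, Complex.ofReal_cpow ht.le]
      push_cast
      congr 2
      field_simp
    simp_rw [Complex.ofReal_mul (Real.exp (-(α ^ 2 / (4 * t)) * _)), ← mul_assoc]
    simp_rw [e5]
    rw [integral_mul_const, this, e2, Complex.ofReal_mul, Complex.mul_cpow_ofReal_nonneg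
      (by positivity) (by positivity), e4, e3]
    ring
  rw [setIntegral_congr_fun measurableSet_Ioi e1, integral_const_mul]
  unfold besselK
  set J := ∫ t in Set.Ioi (0 : ℝ), Complex.exp (-(t : ℂ) - ((α * k : ℝ) : ℂ) ^ 2 / (4 * (t : ℂ))) *
        (t : ℂ) ^ (-(1 - s / 2) - 1) with hJ
  have e6 : (((α * k : ℝ) : ℂ) / 2) ^ (1 - s / 2) * ((2 * k / α : ℝ) : ℂ) ^ (s / 2) =
      (α * k / 2) * ((α ^ 2 / 4 : ℝ) : ℂ) ^ (-(s / 2)) := by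
    have h1 : (2 * k / α : ℝ) = (α * k / 2) * (α ^ 2 / 4)⁻¹ := by field_simp; norm_num
    have h2 : ((α * k : ℝ) : ℂ) / 2 = ((α * k / 2 : ℝ) : ℂ) := by push_cast; rfl
    have h3 : ((α * k / 2 : ℝ) : ℂ) ≠ 0 := by
      have : (0 : ℝ) < α * k / 2 := by positivity
      exact_mod_cast this.ne'
    have h4 : (((α ^ 2 / 4)⁻¹ : ℝ) : ℂ) ^ (s / 2) = ((α ^ 2 / 4 : ℝ) : ℂ) ^ (-(s / 2)) := by
      rw [Complex.ofReal_inv, Complex.inv_cpow _ _ (by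
        rw [Complex.arg_ofReal_of_nonneg (by positivity)]; exact Real.pi_pos.ne), Complex.cpow_neg]
    rw [h1, h2, Complex.ofReal_mul (α * k / 2), Complex.mul_cpow_ofReal_nonneg
      (by positivity) (by positivity), h4, ← mul_assoc, ← Complex.cpow_add _ _ h3,
      sub_add_cancel, Complex.cpow_one]
    push_cast
    rfl
  calc _ = (1 / 2) * Complex.Gamma (s / 2) * J * ((((α * k : ℝ) : ℂ) / 2) ^ (1 - s / 2) *
          ((2 * k / α : ℝ) : ℂ) ^ (s / 2)) := by ring
    _ = _ := by rw [e6]; ring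

lemma mellin_vertical_measurable (α k c : ℝ) (hα : 0 < α) (hk : 0 < k) :
    StronglyMeasurable (fun u : ℝ =>
      mellin (fun y => (radialG α k y : ℂ)) ((c : ℂ) + (u : ℂ) * Complex.I)) := by
  unfold mellin
  have hc := (radialG_continuous α k hα hk).measurable
  have : StronglyMeasurable (Function.uncurry fun (u t : ℝ) =>
      (t : ℂ) ^ (((c : ℂ) + (u : ℂ) * Complex.I) - 1) • (radialG α k t : ℂ)) := by
    apply Measurable.stronglyMeasurable
    unfold Function.uncurry
    fun_prop
  exact this.integral_prod_right

/-- The factorization, with the kernel expressed by the Mellin transform of `radialG`. -/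
lemma swap_aux (α k m c : ℝ) (hα : 0 < α) (hk : 0 < k) (hc : 0 < c)
    (p : ℝ → ℝ) (hp : Measurable p) (hpn : ∀ x, 0 ≤ p x)
    (hint : Integrable (fun z : ℝ × ℝ => p z.1 *
      ‖(2 * k : ℂ) * mellin (fun y => (radialG α k y : ℂ)) ((c : ℂ) + (z.2 : ℂ) * Complex.I)‖ *
      |z.1 - m| ^ (-c))) :
    ∫ u : ℝ, (∫ x : ℝ, (p x : ℂ) * ((|x - m| : ℝ) : ℂ) ^ (-((c : ℂ) + (u : ℂ) * Complex.I))) *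
      ((2 * k : ℂ) * mellin (fun y => (radialG α k y : ℂ)) ((c : ℂ) + (u : ℂ) * Complex.I))
    = ((4 * Real.pi * k * ∫ x : ℝ, p x * radialG α k |x - m| : ℝ) : ℂ) := by
  set M : ℝ → ℂ := fun u => mellin (fun y => (radialG α k y : ℂ)) ((c : ℂ) + (u : ℂ) * Complex.I)
    with hM
  have hk' : (k : ℂ) ≠ 0 := by exact_mod_cast hk.ne'
  have hMm : Measurable M := (mellin_vertical_measurable α k c hα hk).measurable
  by_cases h0 : p =ᵐ[volume] 0
  · have h1 : ∀ u : ℝ, ∫ x : ℝ, (p x : ℂ) *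
        ((|x - m| : ℝ) : ℂ) ^ (-((c : ℂ) + (u : ℂ) * Complex.I)) = 0 := by
      intro u
      apply integral_eq_zero_of_ae
      filter_upwards [h0] with x hx
      simp [hx]
    have h2 : ∫ x : ℝ, p x * radialG α k |x - m| = 0 := by
      apply integral_eq_zero_of_ae
      filter_upwards [h0] with x hx
      simp [hx]
    simp only [h1, h2, zero_mul, integral_zero, mul_zero, Complex.ofReal_zero]
  have hne : ∀ᵐ x : ℝ, x ≠ m := by simp [ae_iff]
  -- vertical integrability
  have hV : Integrable M := by
    have hae := hint.prod_right_ae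
    have hex : ∃ x, p x ≠ 0 ∧ x ≠ m ∧ Integrable (fun u : ℝ => p x * ‖(2 * k : ℂ) * M u‖ *
        |x - m| ^ (-c)) := by
      by_contra hcon
      push Not at hcon
      apply h0
      filter_upwards [hae, hne] with x hx hxm
      by_contra hpx
      exact hcon x hpx hxm hx
    obtain ⟨x, hpx, hxm, hx⟩ := hex
    have hy : 0 < |x - m| := abs_pos.2 (sub_ne_zero.2 hxm)
    have hyc : |x - m| ^ (-c) ≠ 0 := (Real.rpow_pos_of_pos hy _).ne'
    have h1 := hx.mul_const (|x - m| ^ (-c))⁻¹ |>.const_mul ((p x)⁻¹ * (2 * k)⁻¹)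
    refine Integrable.mono' h1 hMm.aestronglyMeasurable (ae_of_all _ fun u => le_of_eq ?_)
    have : ‖(2 * k : ℂ) * M u‖ = 2 * k * ‖M u‖ := by
      rw [norm_mul]
      simp [abs_of_pos hk]
    rw [this]
    field_simp
  have hinv : ∀ y : ℝ, 0 < y → ∫ u : ℝ, (y : ℂ) ^ (-((c : ℂ) + (u : ℂ) * Complex.I)) * M u =
      ((2 * Real.pi * radialG α k y : ℝ) : ℂ) := by
    intro y hy
    have h := mellinInv_mellin_eq c (fun y => (radialG α k y : ℂ)) hy
      (radialG_mellinConvergent α k hα hk c (by simpa using hc)) hV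
      (Complex.continuous_ofReal.comp (radialG_continuous α k hα hk)).continuousAt
    unfold mellinInv at h
    simp only [smul_eq_mul, Complex.real_smul] at h
    rw [Complex.ofReal_mul, ← h, ← mul_assoc, ← Complex.ofReal_mul]
    have : 2 * Real.pi * (1 / (2 * Real.pi)) = 1 := by field_simp
    rw [this]
    simp [hM]
  have hsw : Integrable (Function.uncurry fun (u x : ℝ) => ((p x : ℂ) *
      ((|x - m| : ℝ) : ℂ) ^ (-((c : ℂ) + (u : ℂ) * Complex.I))) * ((2 * k : ℂ) * M u)) := by
    refine Integrable.mono' hint.swap ?_ (ae_of_all _ fun z => le_of_eq ?_)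
    · apply Measurable.aestronglyMeasurable
      unfold Function.uncurry
      fun_prop
    · obtain ⟨u, x⟩ := z
      simp only [Function.uncurry, Function.comp, Prod.swap]
      rw [norm_mul, norm_mul, Complex.norm_real, Real.norm_of_nonneg (hpn x),
        Complex.norm_cpow_eq_rpow_re_of_nonneg (abs_nonneg _) (by simp [hc.ne'])]
      simp only [Complex.neg_re, Complex.add_re, Complex.ofReal_re, Complex.mul_re, Complex.I_re,
        mul_zero, Complex.ofReal_im, Complex.I_im, mul_one, sub_self, add_zero]
      ring
  simp_rw [← integral_mul_const]
  rw [integral_integral_swap hsw, ← integral_const_mul, ← integral_complex_ofReal]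
  apply integral_congr_ae
  filter_upwards [hne] with x hx
  have hy : 0 < |x - m| := abs_pos.2 (sub_ne_zero.2 hx)
  have h := hinv _ hy
  calc _ = ∫ u : ℝ, ((p x : ℂ) * (2 * k)) *
        (((|x - m| : ℝ) : ℂ) ^ (-((c : ℂ) + (u : ℂ) * Complex.I)) * M u) := by
        congr 1
        ext u
        ring
    _ = _ := by
        rw [integral_const_mul, h]
        push_cast
        ring

/-- Factorization in the Mellin space for the symmetric exponential NIG model. -/
theorem mellin_factorization_symmetric
    (α δ μ : ℝ) (hα : 0 < α) (hδ : 0 < δ)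
    (S r q τ : ℝ) (hS : 0 < S) (hr : 0 ≤ r) (hq : 0 ≤ q) (hτ : 0 < τ)
    (ω : ℝ) (hω : ω = -μ + δ * (Real.sqrt (α ^ 2 - 1) - α))
    (P : ℝ → ℝ) (hPmeas : Measurable P) (hPnn : ∀ y, 0 ≤ P y)
    (cm cp : ℝ) (c₁ : ℝ) (hc₁ : 0 < c₁) (hc₁m : cm < c₁) (hc₁p : c₁ < cp)
    (habs : ∀ s : ℝ, cm < s → s < cp →
      Integrable (fun x : ℝ =>
        P (S * Real.exp ((r - q + ω) * τ + x)) * |x - μ * τ| ^ (-s)))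
    (hint : Integrable (fun p : ℝ × ℝ =>
      P (S * Real.exp ((r - q + ω) * τ + p.1)) *
        ‖Complex.Gamma (((c₁ : ℂ) + (p.2 : ℂ) * Complex.I) / 2) *
            besselK (1 - ((c₁ : ℂ) + (p.2 : ℂ) * Complex.I) / 2) (α * δ * τ) *
            ((2 * δ * τ / α : ℝ) : ℂ) ^ (((c₁ : ℂ) + (p.2 : ℂ) * Complex.I) / 2)‖ *
        |p.1 - μ * τ| ^ (-c₁))) :
    ((Real.exp (-r * τ) *
        ∫ x : ℝ, P (S * Real.exp ((r - q + ω) * τ + x)) * nigDensity α δ μ x τ : ℝ) : ℂ)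
      = ((α / (2 * Real.pi) * Real.exp ((α * δ - r) * τ) : ℝ) : ℂ) *
        ((1 / (2 * Real.pi) : ℝ) : ℂ) *
        ∫ u : ℝ,
          Complex.Gamma (((c₁ : ℂ) + (u : ℂ) * Complex.I) / 2) *
            (∫ x : ℝ, (P (S * Real.exp ((r - q + ω) * τ + x)) : ℂ) *
              ((|x - μ * τ| : ℝ) : ℂ) ^ (-((c₁ : ℂ) + (u : ℂ) * Complex.I))) *
            besselK (1 - ((c₁ : ℂ) + (u : ℂ) * Complex.I) / 2) (α * δ * τ) *
            ((2 * δ * τ / α : ℝ) : ℂ) ^ (((c₁ : ℂ) + (u : ℂ) * Complex.I) / 2) := by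
  have hk : 0 < δ * τ := by positivity
  have hH : ∀ u : ℝ, Complex.Gamma (((c₁ : ℂ) + (u : ℂ) * Complex.I) / 2) *
      besselK (1 - ((c₁ : ℂ) + (u : ℂ) * Complex.I) / 2) (α * δ * τ) *
      ((2 * δ * τ / α : ℝ) : ℂ) ^ (((c₁ : ℂ) + (u : ℂ) * Complex.I) / 2) =
      (2 * (δ * τ : ℝ) : ℂ) * mellin (fun y => (radialG α (δ * τ) y : ℂ))
        ((c₁ : ℂ) + (u : ℂ) * Complex.I) := by
    intro u
    rw [← radialG_mellin α (δ * τ) hα hk _ (by simpa using hc₁)]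
    rw [mul_assoc α, mul_assoc 2 δ]
  simp_rw [hH] at hint
  have h := swap_aux α (δ * τ) (μ * τ) c₁ hα hk hc₁
    (fun x => P (S * Real.exp ((r - q + ω) * τ + x)))
    (hPmeas.comp (by fun_prop)) (fun x => hPnn _) hint
  have e1 : ∀ u : ℝ, Complex.Gamma (((c₁ : ℂ) + (u : ℂ) * Complex.I) / 2) *
            (∫ x : ℝ, (P (S * Real.exp ((r - q + ω) * τ + x)) : ℂ) *
              ((|x - μ * τ| : ℝ) : ℂ) ^ (-((c₁ : ℂ) + (u : ℂ) * Complex.I))) *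
            besselK (1 - ((c₁ : ℂ) + (u : ℂ) * Complex.I) / 2) (α * δ * τ) *
            ((2 * δ * τ / α : ℝ) : ℂ) ^ (((c₁ : ℂ) + (u : ℂ) * Complex.I) / 2) =
      (∫ x : ℝ, (P (S * Real.exp ((r - q + ω) * τ + x)) : ℂ) *
              ((|x - μ * τ| : ℝ) : ℂ) ^ (-((c₁ : ℂ) + (u : ℂ) * Complex.I))) *
      ((2 * (δ * τ : ℝ) : ℂ) * mellin (fun y => (radialG α (δ * τ) y : ℂ))
        ((c₁ : ℂ) + (u : ℂ) * Complex.I)) := by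
    intro u
    rw [← hH u]
    ring
  simp_rw [e1]
  rw [h, ← Complex.ofReal_mul, ← Complex.ofReal_mul]
  congr 1
  have e2 : ∀ x : ℝ, P (S * Real.exp ((r - q + ω) * τ + x)) * nigDensity α δ μ x τ =
      (α * (δ * τ) / Real.pi * Real.exp (α * (δ * τ))) *
      (P (S * Real.exp ((r - q + ω) * τ + x)) * radialG α (δ * τ) |x - μ * τ|) := by
    intro x
    rw [nigDensity_eq α δ μ x τ hα hδ hτ]
    ring
  have e3 : Real.exp ((α * δ - r) * τ) = Real.exp (-r * τ) * Real.exp (α * (δ * τ)) := by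
    rw [← Real.exp_add]
    ring_nf
  simp_rw [e2]
  rw [integral_const_mul, e3]
  field_simp
  norm_num
end

section
/- Log call (symmetric model): assume |k₀| < δτ. Then the price C_{log} := e^{−rτ} ∫_ℝ max(k + x, 0) f(x,τ) dx of the log call (payoff (log(S_T/K))⁺) equals C_{log} = e^{−rτ} [ k₀/2 + (α e^{αδτ}/(2π)) · Σ_{n=0}^∞ ((−1)^{n−1} k₀^{2n} / (n! (2n−1))) · K_n(αδτ) · (2δτ/α)^{1−n} ], where the series converges. -/
open MeasureTheory

/-- General term of the log call series in the symmetric model.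
`(-1) ^ (n + 1)` realizes the sign `(-1) ^ (n - 1)` for all `n : ℕ`. -/
noncomputable def logTerm (α δ τ k₀ : ℝ) (n : ℕ) : ℝ :=
  (-1 : ℝ) ^ (n + 1) * k₀ ^ (2 * n) / ((n.factorial : ℝ) * (2 * (n : ℝ) - 1)) *
    besselKr (n : ℝ) (α * δ * τ) *
    (2 * δ * τ / α) ^ (1 - (n : ℝ))


lemma hsc {f g : ℕ → ℝ} {a : ℝ} (h : HasSum g a) (e : ∀ n, f n = g n) : HasSum f a := by
  rwa [funext e]

lemma expsum (x : ℝ) : HasSum (fun n : ℕ => x ^ n / (n.factorial : ℝ)) (Real.exp x) := by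
  rw [Real.exp_eq_exp_ℝ]
  exact NormedSpace.expSeries_div_hasSum_exp x

lemma intA (B s : ℝ) (hB : 0 < B) :
    IntegrableOn (fun t : ℝ => Real.exp (-t - B / t) * t ^ s) (Set.Ioi 0) := by
  obtain ⟨m, hm⟩ := exists_nat_gt (-s)
  have hG := (Real.GammaIntegral_convergent (s := s + m + 1) (by linarith)).const_mul
    ((m.factorial : ℝ) / B ^ m)
  refine Integrable.mono' hG ?_ ?_
  · refine ContinuousOn.aestronglyMeasurable ?_ measurableSet_Ioi
    intro t ht
    have ht' : t ≠ 0 := ne_of_gt ht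
    apply ContinuousAt.continuousWithinAt
    have : ContinuousAt (fun t : ℝ => t ^ s) t := Real.continuousAt_rpow_const t s (Or.inl ht')
    fun_prop (disch := assumption)
  · refine (ae_restrict_iff' measurableSet_Ioi).2 (Filter.Eventually.of_forall ?_)
    intro t ht
    have ht : 0 < t := ht
    have h1 := Real.pow_div_factorial_le_exp (x := B / t) (by positivity) m
    rw [Real.norm_of_nonneg (by positivity), sub_eq_add_neg, Real.exp_add, Real.exp_neg (B / t)]
    have h2 : (Real.exp (B / t))⁻¹ ≤ ((B / t) ^ m / (m.factorial : ℝ))⁻¹ := by gcongr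
    have h3 : t ^ (s + m + 1 - 1) = t ^ s * t ^ m := by
      rw [add_sub_cancel_right, Real.rpow_add ht, Real.rpow_natCast]
    rw [h3]
    calc Real.exp (-t) * (Real.exp (B / t))⁻¹ * t ^ s
        ≤ Real.exp (-t) * ((B / t) ^ m / (m.factorial : ℝ))⁻¹ * t ^ s := by gcongr
      _ = _ := by rw [div_pow]; field_simp

noncomputable def Eg (x : ℝ) : ℝ := ∫ s in (0:ℝ)..x, Real.exp (-1 * s ^ 2)

lemma Eg_deriv (x : ℝ) : HasDerivAt Eg (Real.exp (-1 * x ^ 2)) x := by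
  have hc : Continuous (fun s : ℝ => Real.exp (-1 * s ^ 2)) := by fun_prop
  exact intervalIntegral.integral_hasDerivAt_right (hc.intervalIntegrable _ _)
    (hc.stronglyMeasurableAtFilter _ _) hc.continuousAt

lemma Eg_top : Filter.Tendsto Eg Filter.atTop (nhds (√Real.pi / 2)) := by
  have h := intervalIntegral_tendsto_integral_Ioi (0:ℝ)
    (integrable_exp_neg_mul_sq (b := 1) one_pos).integrableOn Filter.tendsto_id
  rw [integral_gaussian_Ioi] at h
  have h2 : √(Real.pi / 1) / 2 = √Real.pi / 2 := by rw [div_one]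
  rw [h2] at h
  exact h

lemma Eg_neg (x : ℝ) : Eg (-x) = - Eg x := by
  unfold Eg
  have := intervalIntegral.integral_comp_neg (a := 0) (b := x) (fun s : ℝ => Real.exp (-1 * s ^ 2))
  simp only [neg_zero, neg_sq] at this
  rw [this, intervalIntegral.integral_symm]

lemma Eg_bot : Filter.Tendsto Eg Filter.atBot (nhds (-(√Real.pi / 2))) := by
  have h := (Eg_top.comp Filter.tendsto_neg_atBot_atTop).neg
  refine h.congr fun x => ?_
  simp [Eg_neg]

lemma Khalf (b : ℝ) (hb : 0 < b) :
    ∫ t in Set.Ioi (0:ℝ), Real.exp (-t - b ^ 2 / t) * t ^ (-(3:ℝ)/2) =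
      √Real.pi / b * Real.exp (-2 * b) := by
  have hIntg := (intA (b ^ 2) (-(3:ℝ)/2) (by positivity)).const_mul b
  set f : ℝ → ℝ := fun t => Real.exp (-2*b) * Eg (√t - b / √t) - Real.exp (2*b) * Eg (√t + b/√t)
    with hf
  have hsq0 : Filter.Tendsto (fun t : ℝ => √t) (nhdsWithin 0 (Set.Ioi 0))
      (nhdsWithin 0 (Set.Ioi 0)) := by
    refine tendsto_nhdsWithin_iff.2 ⟨?_, ?_⟩
    · have := (Real.continuous_sqrt.tendsto 0).mono_left (nhdsWithin_le_nhds (s := Set.Ioi 0))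
      simpa using this
    · filter_upwards [self_mem_nhdsWithin] with t ht
      exact Real.sqrt_pos.2 ht
  have hbs : Filter.Tendsto (fun t : ℝ => b / √t) (nhdsWithin 0 (Set.Ioi 0)) Filter.atTop := by
    have := (tendsto_inv_nhdsGT_zero.comp hsq0).const_mul_atTop hb
    simpa [div_eq_mul_inv] using this
  have hs0 : Filter.Tendsto (fun t : ℝ => √t) (nhdsWithin 0 (Set.Ioi 0)) (nhds 0) :=
    hsq0.mono_right nhdsWithin_le_nhds
  have hbt : Filter.Tendsto (fun t : ℝ => b / √t) Filter.atTop (nhds 0) :=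
    Real.tendsto_sqrt_atTop.const_div_atTop b
  have hzero : Filter.Tendsto f (nhdsWithin 0 (Set.Ioi 0))
      (nhds (Real.exp (-2*b) * (-(√Real.pi/2)) - Real.exp (2*b) * (√Real.pi/2))) := by
    refine Filter.Tendsto.sub (Filter.Tendsto.const_mul _ ?_) (Filter.Tendsto.const_mul _ ?_)
    · refine Eg_bot.comp ?_
      have := hs0.add_atBot (Filter.tendsto_neg_atTop_atBot.comp hbs)
      simpa [sub_eq_add_neg] using this
    · exact Eg_top.comp (hs0.add_atTop hbs)
  have htop : Filter.Tendsto f Filter.atTop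
      (nhds (Real.exp (-2*b) * ((√Real.pi/2)) - Real.exp (2*b) * (√Real.pi/2))) := by
    refine Filter.Tendsto.sub (Filter.Tendsto.const_mul _ ?_) (Filter.Tendsto.const_mul _ ?_)
    · refine Eg_top.comp ?_
      have := Real.tendsto_sqrt_atTop.atTop_add hbt.neg
      simpa [sub_eq_add_neg] using this
    · exact Eg_top.comp (Real.tendsto_sqrt_atTop.atTop_add hbt)
  have hder : ∀ t ∈ Set.Ioi (0:ℝ),
      HasDerivAt f (b * (Real.exp (-t - b ^ 2 / t) * t ^ (-(3:ℝ)/2))) t := by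
    intro t ht
    have ht : 0 < t := ht
    have hs : 0 < √t := Real.sqrt_pos.2 ht
    have hss : √t * √t = t := Real.mul_self_sqrt ht.le
    have d1 : HasDerivAt (fun t : ℝ => √t) (1 / (2 * √t)) t := Real.hasDerivAt_sqrt ht.ne'
    have d2 : HasDerivAt (fun t : ℝ => b / √t) ((0 * √t - b * (1 / (2 * √t))) / √t ^ 2) t :=
      (hasDerivAt_const t b).div d1 hs.ne'
    have e1 := ((Eg_deriv _).comp t (d1.sub d2)).const_mul (Real.exp (-2*b))
    have e2 := ((Eg_deriv _).comp t (d1.add d2)).const_mul (Real.exp (2*b))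
    have e := e1.sub e2
    have hp : t ^ (-(3:ℝ)/2) = 1 / √t ^ 3 := by
      rw [Real.sqrt_eq_rpow, ← Real.rpow_natCast, ← Real.rpow_mul ht.le, one_div,
        ← Real.rpow_neg ht.le]
      norm_num
    have x1 : Real.exp (-t - b^2/t) = Real.exp (-2*b) * Real.exp (-1 * (√t - b/√t)^2) := by
      rw [← Real.exp_add]; congr 1
      have : (√t - b/√t)^2 = t - 2 * b + b^2/t := by
        have h5 : b ^ 2 / t = b ^ 2 / (√t * √t) := by rw [hss]
        have h6 : t - 2 * b = √t * √t - 2 * b := by rw [hss]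
        rw [h5, h6]; field_simp; ring
      rw [this]; ring
    have x2 : Real.exp (-t - b^2/t) = Real.exp (2*b) * Real.exp (-1 * (√t + b/√t)^2) := by
      rw [← Real.exp_add]; congr 1
      have : (√t + b/√t)^2 = t + 2 * b + b^2/t := by
        have h5 : b ^ 2 / t = b ^ 2 / (√t * √t) := by rw [hss]
        have h6 : t + 2 * b = √t * √t + 2 * b := by rw [hss]
        rw [h5, h6]; field_simp; ring
      rw [this]; ring
    refine e.congr_deriv ?_
    simp only [Pi.sub_apply, Pi.add_apply]
    rw [← mul_assoc, ← mul_assoc, ← x1, ← x2, hp]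
    field_simp
    ring
  have key : ∫ t in Set.Ioi (0:ℝ), b * (Real.exp (-t - b ^ 2 / t) * t ^ (-(3:ℝ)/2)) =
      (Real.exp (-2*b) * ((√Real.pi/2)) - Real.exp (2*b) * (√Real.pi/2)) -
      (Real.exp (-2*b) * (-(√Real.pi/2)) - Real.exp (2*b) * (√Real.pi/2)) := by
    rw [← Set.Ici_sdiff_left] at hzero
    have h := integral_Ioi_of_hasDerivAt_of_tendsto (f := Function.update f 0 _)
      (continuousWithinAt_update_same.mpr hzero) (fun t ht => (hder t ht).congr_of_eventuallyEq ?_)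
      hIntg (m := (Real.exp (-2*b) * ((√Real.pi/2)) - Real.exp (2*b) * (√Real.pi/2))) ?_
    · simpa only [Function.update_self] using h
    · filter_upwards [eventually_ne_nhds (ne_of_gt ht)] with y hy
      exact Function.update_of_ne hy _ f
    · refine htop.congr' ?_
      filter_upwards [Filter.eventually_ne_atTop 0] with x hx
      exact (Function.update_of_ne hx _ f).symm
  rw [integral_const_mul] at key
  rw [div_mul_eq_mul_div, eq_div_iff hb.ne']
  linarith

/-- truncated Gaussian mean -/
lemma gaussG (a k : ℝ) (ha : 0 < a) :
    Integrable (fun y : ℝ => max (k + y) 0 * Real.exp (-a * y ^ 2)) ∧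
    ∫ y : ℝ, max (k + y) 0 * Real.exp (-a * y ^ 2) =
      k / 2 * √(Real.pi / a) +
        (k * (∫ s in (0:ℝ)..k, Real.exp (-a * s ^ 2)) + Real.exp (-a * k ^ 2) / (2 * a)) := by
  have hg := integrable_exp_neg_mul_sq ha
  have hg1 := integrable_mul_exp_neg_mul_sq ha
  have hlin : Integrable (fun y : ℝ => (k + y) * Real.exp (-a * y ^ 2)) := by
    simp only [add_mul]
    exact (hg.const_mul k).add hg1
  have heq : (fun y : ℝ => max (k + y) 0 * Real.exp (-a * y ^ 2)) =
      Set.indicator (Set.Ioi (-k)) (fun y : ℝ => (k + y) * Real.exp (-a * y ^ 2)) := by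
    ext y
    by_cases hy : y ∈ Set.Ioi (-k)
    · rw [Set.indicator_of_mem hy, max_eq_left]
      have : -k < y := hy
      linarith
    · rw [Set.indicator_of_notMem hy, max_eq_right, zero_mul]
      have : ¬ (-k < y) := hy
      linarith
  refine ⟨heq ▸ hlin.indicator measurableSet_Ioi, ?_⟩
  rw [heq, integral_indicator measurableSet_Ioi]
  have hsplit : ∫ y in Set.Ioi (-k), (k + y) * Real.exp (-a * y ^ 2) =
      k * (∫ y in Set.Ioi (-k), Real.exp (-a * y ^ 2)) +
        ∫ y in Set.Ioi (-k), y * Real.exp (-a * y ^ 2) := by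
    simp only [add_mul]
    rw [integral_add (hg.const_mul k).integrableOn hg1.integrableOn, integral_const_mul]
  have h1 : ∫ y in Set.Ioi (-k), Real.exp (-a * y ^ 2) =
      √(Real.pi / a) / 2 + ∫ s in (0:ℝ)..k, Real.exp (-a * s ^ 2) := by
    have := intervalIntegral.integral_Ioi_sub_Ioi' (a := -k) (b := 0) (μ := volume)
      hg.integrableOn hg.integrableOn
    rw [integral_gaussian_Ioi] at this
    have h2 := intervalIntegral.integral_comp_neg (a := 0) (b := k)
      (fun s : ℝ => Real.exp (-a * s ^ 2))
    simp only [neg_zero, neg_sq] at h2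
    rw [h2]; linarith
  have h3 : ∫ y in Set.Ioi (-k), y * Real.exp (-a * y ^ 2) = Real.exp (-a * k ^ 2) / (2 * a) := by
    have h := integral_Ioi_of_hasDerivAt_of_tendsto' (a := -k) (m := 0)
      (f := fun y : ℝ => - (Real.exp (-a * y ^ 2) / (2 * a)))
      (f' := fun y => y * Real.exp (-a * y ^ 2)) ?_ hg1.integrableOn ?_
    · rw [h]; simp
    · intro x _
      have d := (((hasDerivAt_pow 2 x).const_mul (-a)).exp.div_const (2 * a)).neg
      refine d.congr_deriv ?_
      field_simp
      norm_num
      ring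
    · have : Filter.Tendsto (fun y : ℝ => -a * y ^ 2) Filter.atTop Filter.atBot :=
        (Filter.tendsto_pow_atTop two_ne_zero).const_mul_atTop_of_neg (by linarith)
      have := ((Real.tendsto_exp_atBot.comp this).div_const (2 * a)).neg
      simpa using this
  rw [hsplit, h1, h3]
  ring

lemma gaussInt (a k : ℝ) :
    HasSum (fun n : ℕ => (-a) ^ n * k ^ (2 * n + 1) / ((n.factorial : ℝ) * (2 * (n:ℝ) + 1)))
      (∫ s in (0:ℝ)..k, Real.exp (-a * s ^ 2)) := by
  have h := intervalIntegral.hasSum_integral_of_dominated_convergence (μ := volume) (a := 0) (b := k)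
    (F := fun (n : ℕ) (s : ℝ) => (-a * s ^ 2) ^ n / (n.factorial : ℝ))
    (f := fun s => Real.exp (-a * s ^ 2))
    (fun n _ => (|a| * k ^ 2) ^ n / (n.factorial : ℝ)) ?_ ?_ ?_ ?_ ?_
  · refine hsc h fun n => ?_
    simp only [mul_pow, ← pow_mul]
    rw [intervalIntegral.integral_div, intervalIntegral.integral_const_mul, integral_pow]
    push_cast
    have : (n.factorial : ℝ) ≠ 0 := by positivity
    field_simp
    simp
  · intro n
    exact Continuous.aestronglyMeasurable (by fun_prop)
  · intro n
    refine Filter.Eventually.of_forall fun s hs => ?_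
    have hs2 : s ^ 2 ≤ k ^ 2 := by
      rw [sq_le_sq]
      rcases Set.mem_uIoc.1 hs with h | h
      · rw [abs_of_pos h.1, abs_of_pos (h.1.trans_le h.2)]; exact h.2
      · rw [abs_of_nonpos h.2, abs_of_neg (h.1.trans_le h.2)]; linarith [h.1]
    rw [norm_div, norm_pow, norm_mul, norm_neg, Real.norm_eq_abs, Real.norm_eq_abs, abs_sq,
      Real.norm_natCast]
    gcongr
  · exact Filter.Eventually.of_forall fun s _ => (expsum _).summable
  · simp
  · exact Filter.Eventually.of_forall fun s _ => expsum _

lemma gaussSeries (a k : ℝ) (ha : 0 < a) :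
    HasSum (fun n : ℕ => (-1 : ℝ) ^ (n + 1) * k ^ (2 * n) * (a ^ n / a) /
        (2 * ((n.factorial : ℝ) * (2 * (n:ℝ) - 1))))
      (k * (∫ s in (0:ℝ)..k, Real.exp (-a * s ^ 2)) + Real.exp (-a * k ^ 2) / (2 * a)) := by
  have h1 := (gaussInt a k).mul_left k
  have h2 := (expsum (-a * k ^ 2)).div_const (2 * a)
  let p : ℕ → ℝ := fun n => (-1 : ℝ) ^ (n + 1) * k ^ (2 * n) * (a ^ n / a) * (2 * n) /
        (2 * ((n.factorial : ℝ) * (2 * (n:ℝ) - 1)))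
  have hp : HasSum p (k * (∫ s in (0:ℝ)..k, Real.exp (-a * s ^ 2))) := by
    rw [← hasSum_nat_add_iff' 1]
    simp only [Finset.range_one, Finset.sum_singleton]
    have hp0 : p 0 = 0 := by simp [p]
    rw [hp0, sub_zero]
    refine hsc h1 fun n => ?_
    simp only [p]
    have : (2 * ((n:ℝ) + 1) - 1) ≠ 0 := by
      have : (0:ℝ) ≤ n := Nat.cast_nonneg n
      linarith
    have h' : (2 * (n:ℝ) + 1) ≠ 0 := by positivity
    have hm : (-a) ^ n = (-1) ^ n * a ^ n := by rw [← mul_pow]; ring_nf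
    rw [Nat.factorial_succ, hm]
    push_cast
    have h3 : (2 * ((n:ℝ) + 1) - 1) = 2 * n + 1 := by ring
    rw [h3]
    have : (n.factorial : ℝ) ≠ 0 := by positivity
    field_simp
    ring
  convert hp.add h2 using 2 with n
  simp only [p]
  have h4 : (2 * (n:ℝ) - 1) ≠ 0 := by
    intro h
    have : (2 * (n:ℤ) - 1) = 0 := by exact_mod_cast h
    omega
  have : (n.factorial : ℝ) ≠ 0 := by positivity
  have hm : (-a * k ^ 2) ^ n = (-1) ^ n * a ^ n * k ^ (2 * n) := by
    rw [pow_mul, ← mul_pow, ← mul_pow]; ring_nf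
  rw [hm]
  field_simp
  ring

lemma two_sub_ne (n : ℕ) : (2 * (n:ℝ) - 1) ≠ 0 := by
  intro h
  have : (2 * (n:ℤ) - 1) = 0 := by exact_mod_cast h
  omega

lemma one_le_abs_two_sub (n : ℕ) : 1 ≤ |2 * (n:ℝ) - 1| := by
  have : (1:ℤ) ≤ |2 * (n:ℤ) - 1| := Int.one_le_abs (by omega)
  exact_mod_cast this

noncomputable def Sg (a k : ℝ) : ℝ :=
  k * (∫ s in (0:ℝ)..k, Real.exp (-a * s ^ 2)) + Real.exp (-a * k ^ 2) / (2 * a)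

lemma term_bound (a k : ℝ) (ha : 0 < a) (n : ℕ) :
    ‖(-1 : ℝ) ^ (n + 1) * k ^ (2 * n) * (a ^ n / a) /
        (2 * ((n.factorial : ℝ) * (2 * (n:ℝ) - 1)))‖ ≤
      (a * k ^ 2) ^ n / (n.factorial : ℝ) / (2 * a) := by
  have h1 := one_le_abs_two_sub n
  rw [norm_div, norm_mul, norm_mul, norm_mul, norm_mul, norm_pow, norm_neg, norm_one, one_pow,
    one_mul, Real.norm_natCast, Real.norm_of_nonneg (by rw [pow_mul]; positivity),
    Real.norm_of_nonneg (by positivity), Real.norm_eq_abs, Real.norm_eq_abs (2 * (n:ℝ) - 1),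
    abs_two]
  have e : (a * k ^ 2) ^ n / (n.factorial : ℝ) / (2 * a) =
      k ^ (2 * n) * (a ^ n / a) / (2 * ((n.factorial : ℝ) * 1)) := by
    rw [mul_pow, ← pow_mul]; field_simp
  rw [e]
  have : 0 ≤ k ^ (2 * n) := by rw [pow_mul]; positivity
  gcongr

lemma Sg_bound (a k : ℝ) (ha : 0 < a) : ‖Sg a k‖ ≤ Real.exp (a * k ^ 2) / (2 * a) :=
  (gaussSeries a k ha).norm_le_of_bounded ((expsum _).div_const _) (term_bound a k ha)

/-- Everything after scaling: `A = α² / 4`. -/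
lemma mainInt (A c k : ℝ) (hA : 0 < A) (hk : |k| < c) :
    HasSum (fun n : ℕ => (-1 : ℝ) ^ (n + 1) * k ^ (2 * n) * (A ^ n / A) /
        (2 * ((n.factorial : ℝ) * (2 * (n:ℝ) - 1))) *
        ∫ t in Set.Ioi (0:ℝ), Real.exp (-t - A * c ^ 2 / t) * t ^ (-(n:ℝ) - 1))
      ((∫ y : ℝ, max (k + y) 0 * ∫ t in Set.Ioi (0:ℝ),
          Real.exp (-t - A * c ^ 2 / t) * t ^ (-2:ℝ) * Real.exp (-(A / t) * y ^ 2))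
        - k / 2 * (√(Real.pi / A) *
          ∫ t in Set.Ioi (0:ℝ), Real.exp (-t - A * c ^ 2 / t) * t ^ (-(3:ℝ)/2))) := by
  have hc : 0 < c := (abs_nonneg k).trans_lt hk
  have hkc : 0 < c ^ 2 - k ^ 2 := by
    have := sq_lt_sq' (abs_lt.1 hk).1 (abs_lt.1 hk).2
    linarith
  have hB : 0 < A * c ^ 2 := by positivity
  set W : ℝ → ℝ := fun t => Real.exp (-t - A * c ^ 2 / t) * t ^ (-2:ℝ) with hW
  have hWpos : ∀ t ∈ Set.Ioi (0:ℝ), 0 < W t := fun t ht => by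
    have ht : 0 < t := ht
    positivity
  have hWm : Measurable W := by fun_prop
  have e1 : ∀ t ∈ Set.Ioi (0:ℝ), W t * √(Real.pi / (A / t)) =
      √(Real.pi / A) * (Real.exp (-t - A * c ^ 2 / t) * t ^ (-(3:ℝ)/2)) := by
    intro t ht
    have ht : 0 < t := ht
    have : Real.pi / (A / t) = Real.pi / A * t := by field_simp
    rw [this, Real.sqrt_mul (by positivity), Real.sqrt_eq_rpow t]
    have : t ^ (-(3:ℝ)/2) = t ^ (-2:ℝ) * t ^ (1/2:ℝ) := by
      rw [← Real.rpow_add ht]; norm_num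
    rw [this]; ring
  have i1 : IntegrableOn (fun t => W t * √(Real.pi / (A / t))) (Set.Ioi 0) := by
    refine IntegrableOn.congr_fun ?_ (fun t ht => (e1 t ht).symm) measurableSet_Ioi
    exact (intA _ _ hB).const_mul _
  have e2 : ∀ t ∈ Set.Ioi (0:ℝ), W t * (Real.exp (A / t * k ^ 2) / (2 * (A / t))) =
      1 / (2 * A) * (Real.exp (-t - A * (c ^ 2 - k ^ 2) / t) * t ^ (-1:ℝ)) := by
    intro t ht
    have ht : 0 < t := ht
    have h1 : Real.exp (-t - A * (c ^ 2 - k ^ 2) / t) =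
        Real.exp (-t - A * c ^ 2 / t) * Real.exp (A / t * k ^ 2) := by
      rw [← Real.exp_add]; congr 1; ring
    have h2 : t ^ (-1:ℝ) = t ^ (-2:ℝ) * t := by
      rw [← Real.rpow_add_one ht.ne']; norm_num
    rw [h1, h2]
    simp only [hW]
    field_simp
  have i2 : IntegrableOn (fun t => W t * (Real.exp (A / t * k ^ 2) / (2 * (A / t)))) (Set.Ioi 0) := by
    refine IntegrableOn.congr_fun ?_ (fun t ht => (e2 t ht).symm) measurableSet_Ioi
    exact (intA _ _ (by positivity)).const_mul _
  let f : ℝ → ℝ → ℝ := fun y t => max (k + y) 0 * (W t * Real.exp (-(A / t) * y ^ 2))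
  have hfm : Measurable (Function.uncurry f) := by
    simp only [f, Function.uncurry_def]
    fun_prop
  have hG : ∀ t ∈ Set.Ioi (0:ℝ), ∫ y, f y t = W t * (k / 2 * √(Real.pi / (A / t)) + Sg (A / t) k) := by
    intro t ht
    have ht : 0 < t := ht
    rw [Sg, ← (gaussG (A / t) k (by positivity)).2, ← integral_const_mul]
    congr 1; ext y; simp only [f]; ring
  have hfint : ∀ t ∈ Set.Ioi (0:ℝ), Integrable (fun y => f y t) := by
    intro t ht
    have ht : 0 < t := ht
    refine ((gaussG (A / t) k (by positivity)).1.const_mul (W t)).congr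
      (Filter.Eventually.of_forall fun y => ?_)
    simp only [f]; ring
  have iG : IntegrableOn (fun t => ∫ y, f y t) (Set.Ioi 0) := by
    refine Integrable.mono' ((i1.const_mul (|k| / 2)).add i2) ?_ ?_
    · have := hfm.stronglyMeasurable.integral_prod_left' (μ := volume)
      exact this.aestronglyMeasurable
    · refine (ae_restrict_iff' measurableSet_Ioi).2 (Filter.Eventually.of_forall fun t ht => ?_)
      rw [hG t ht]
      have hw := hWpos t ht
      have ht : 0 < t := ht
      have hb := Sg_bound (A / t) k (by positivity)
      simp only [Pi.add_apply]
      rw [norm_mul, Real.norm_of_nonneg hw.le]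
      calc W t * ‖k / 2 * √(Real.pi / (A / t)) + Sg (A / t) k‖
          ≤ W t * (‖k / 2 * √(Real.pi / (A / t))‖ + ‖Sg (A / t) k‖) := by
            gcongr; exact norm_add_le _ _
        _ ≤ W t * (|k| / 2 * √(Real.pi / (A / t)) + Real.exp (A / t * k ^ 2) / (2 * (A / t))) := by
            gcongr
            rw [norm_mul, norm_div, Real.norm_of_nonneg (Real.sqrt_nonneg _)]
            simp
        _ = _ := by ring
  have iP : Integrable (Function.uncurry f) (volume.prod (volume.restrict (Set.Ioi 0))) := by
    rw [integrable_prod_iff' hfm.aestronglyMeasurable]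
    refine ⟨(ae_restrict_iff' measurableSet_Ioi).2 (Filter.Eventually.of_forall hfint), ?_⟩
    refine IntegrableOn.congr_fun iG (fun t ht => ?_) measurableSet_Ioi
    simp only [Function.uncurry_apply_pair]
    congr 1; ext y
    have := (hWpos t ht).le
    rw [Real.norm_of_nonneg]
    exact mul_nonneg (le_max_right _ _) (by positivity)
  have hswap := integral_integral_swap iP
  have hL : ∫ y, max (k + y) 0 * ∫ t in Set.Ioi (0:ℝ), W t * Real.exp (-(A / t) * y ^ 2) =
      ∫ y, ∫ t in Set.Ioi (0:ℝ), f y t := by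
    congr 1; ext y
    rw [← integral_const_mul]
  have iS : IntegrableOn (fun t => W t * Sg (A / t) k) (Set.Ioi 0) := by
    refine IntegrableOn.congr_fun (iG.sub (i1.const_mul (k / 2))) (fun t ht => ?_) measurableSet_Ioi
    simp only [Pi.sub_apply]
    rw [hG t ht]; ring
  have hR : ∫ t in Set.Ioi (0:ℝ), ∫ y, f y t =
      k / 2 * (√(Real.pi / A) *
          ∫ t in Set.Ioi (0:ℝ), Real.exp (-t - A * c ^ 2 / t) * t ^ (-(3:ℝ)/2)) +
        ∫ t in Set.Ioi (0:ℝ), W t * Sg (A / t) k := by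
    rw [← integral_const_mul (√(Real.pi / A)), ← setIntegral_congr_fun measurableSet_Ioi e1,
      ← integral_const_mul, ← integral_add (i1.const_mul (k / 2)) iS]
    refine setIntegral_congr_fun measurableSet_Ioi fun t ht => ?_
    beta_reduce
    rw [hG t ht]; ring
  rw [hL, hswap, hR, add_sub_cancel_left]
  have hs := hasSum_integral_of_dominated_convergence (μ := volume.restrict (Set.Ioi (0:ℝ)))
    (F := fun (n : ℕ) t => W t * ((-1 : ℝ) ^ (n + 1) * k ^ (2 * n) * ((A / t) ^ n / (A / t)) /
        (2 * ((n.factorial : ℝ) * (2 * (n:ℝ) - 1)))))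
    (f := fun t => W t * Sg (A / t) k)
    (fun n t => W t * ((A / t * k ^ 2) ^ n / (n.factorial : ℝ) / (2 * (A / t)))) ?_ ?_ ?_ ?_ ?_
  · refine hsc hs fun n => ?_
    rw [← integral_const_mul]
    refine setIntegral_congr_fun measurableSet_Ioi fun t ht => ?_
    have ht : 0 < t := ht
    have h1 : t ^ (-(n:ℝ) - 1) = t ^ (-2:ℝ) * (t / t ^ n) := by
      have h2 : t / t ^ n = t ^ (1 - (n:ℝ)) := by
        rw [Real.rpow_sub ht, Real.rpow_one, Real.rpow_natCast]
      rw [h2, ← Real.rpow_add ht]; congr 1; ring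
    simp only [hW, h1]
    have := two_sub_ne n
    rw [div_pow]
    field_simp
  · intro n
    refine Measurable.aestronglyMeasurable ?_
    fun_prop
  · intro n
    refine (ae_restrict_iff' measurableSet_Ioi).2 (Filter.Eventually.of_forall fun t ht => ?_)
    have hw := hWpos t ht
    have ht : 0 < t := ht
    rw [norm_mul, Real.norm_of_nonneg hw.le]
    gcongr
    exact term_bound (A / t) k (by positivity) n
  · exact Filter.Eventually.of_forall fun t => (((expsum _).div_const _).mul_left _).summable
  · refine i2.congr (Filter.Eventually.of_forall fun t => ?_)
    exact (((expsum _).div_const _).mul_left _).tsum_eq.symm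
  · refine (ae_restrict_iff' measurableSet_Ioi).2 (Filter.Eventually.of_forall fun t ht => ?_)
    have ht : 0 < t := ht
    exact (gaussSeries (A / t) k (by positivity)).mul_left _

lemma nig_mix (α δ μ τ y : ℝ) (hα : 0 < α) (hδ : 0 < δ) (hτ : 0 < τ) :
    nigDensity α δ μ (y + μ * τ) τ =
      (α ^ 2 * (δ * τ) / (4 * Real.pi) * Real.exp (α * δ * τ)) *
        ∫ t in Set.Ioi (0:ℝ), Real.exp (-t - α ^ 2 / 4 * (δ * τ) ^ 2 / t) * t ^ (-2:ℝ) *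
          Real.exp (-(α ^ 2 / 4 / t) * y ^ 2) := by
  have hR : 0 < √((δ * τ) ^ 2 + y ^ 2) := Real.sqrt_pos.2 (by positivity)
  have hsq : √((δ * τ) ^ 2 + y ^ 2) ^ 2 = (δ * τ) ^ 2 + y ^ 2 := Real.sq_sqrt (by positivity)
  have hI : ∫ t in Set.Ioi (0:ℝ), Real.exp (-t - (α * √((δ * τ) ^ 2 + y ^ 2)) ^ 2 / (4 * t)) *
        t ^ (-1 - 1:ℝ) =
      ∫ t in Set.Ioi (0:ℝ), Real.exp (-t - α ^ 2 / 4 * (δ * τ) ^ 2 / t) * t ^ (-2:ℝ) *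
          Real.exp (-(α ^ 2 / 4 / t) * y ^ 2) := by
    refine setIntegral_congr_fun measurableSet_Ioi fun t ht => ?_
    have ht : 0 < t := ht
    beta_reduce
    rw [mul_right_comm, ← Real.exp_add, mul_pow, hsq]
    congr 2
    · field_simp; ring
    · norm_num
  unfold nigDensity besselKr
  rw [add_sub_cancel_right, hI, Real.rpow_one]
  generalize (∫ t in Set.Ioi (0:ℝ), Real.exp (-t - α ^ 2 / 4 * (δ * τ) ^ 2 / t) * t ^ (-2:ℝ) *
          Real.exp (-(α ^ 2 / 4 / t) * y ^ 2)) = I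
  field_simp
  ring

/-- Log call pricing formula in the symmetric exponential NIG model. -/
theorem log_call_symmetric
    (α δ μ S K r q τ : ℝ)
    (hα : 0 < α) (hδ : 0 < δ) (hS : 0 < S) (hK : 0 < K)
    (hr : 0 ≤ r) (hq : 0 ≤ q) (hτ : 0 < τ)
    (ω k k₀ : ℝ)
    (hω : ω = -μ + δ * (Real.sqrt (α ^ 2 - 1) - α))
    (hk : k = Real.log (S / K) + (r - q + ω) * τ)
    (hk₀ : k₀ = k + μ * τ)
    (hconv : |k₀| < δ * τ) :
    Summable (fun n : ℕ => logTerm α δ τ k₀ n) ∧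
    Real.exp (-r * τ) * (∫ x : ℝ, max (k + x) 0 * nigDensity α δ μ x τ)
      = Real.exp (-r * τ) *
          (k₀ / 2 + α * Real.exp (α * δ * τ) / (2 * Real.pi) *
            ∑' n : ℕ, logTerm α δ τ k₀ n) := by
  have hc : 0 < δ * τ := by positivity
  have hA : 0 < α ^ 2 / 4 := by positivity
  have hs := mainInt (α ^ 2 / 4) (δ * τ) k₀ hA hconv
  set C : ℝ := α ^ 2 * (δ * τ) / (4 * Real.pi) * Real.exp (α * δ * τ) with hC
  have hIntg : ∫ x : ℝ, max (k + x) 0 * nigDensity α δ μ x τ =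
      C * ∫ y : ℝ, max (k₀ + y) 0 * ∫ t in Set.Ioi (0:ℝ),
        Real.exp (-t - α ^ 2 / 4 * (δ * τ) ^ 2 / t) * t ^ (-2:ℝ) *
          Real.exp (-(α ^ 2 / 4 / t) * y ^ 2) := by
    rw [← integral_add_right_eq_self _ (μ * τ), ← integral_const_mul]
    congr 1; ext y
    rw [nig_mix α δ μ τ y hα hδ hτ, hk₀, ← hC]
    have : k + (y + μ * τ) = k + μ * τ + y := by ring
    rw [this]; ring
  have hK2 : C * (√(Real.pi / (α ^ 2 / 4)) * ∫ t in Set.Ioi (0:ℝ),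
      Real.exp (-t - α ^ 2 / 4 * (δ * τ) ^ 2 / t) * t ^ (-(3:ℝ)/2)) = 1 := by
    have h := Khalf (α * (δ * τ) / 2) (by positivity)
    have e : (α * (δ * τ) / 2) ^ 2 = α ^ 2 / 4 * (δ * τ) ^ 2 := by ring
    rw [e] at h
    have e2 : √(Real.pi / (α ^ 2 / 4)) = √Real.pi / (α / 2) := by
      rw [Real.sqrt_div Real.pi_pos.le]
      congr 1
      rw [show α ^ 2 / 4 = (α / 2) ^ 2 by ring, Real.sqrt_sq (by positivity)]
    have e3 : Real.exp (-2 * (α * (δ * τ) / 2)) = (Real.exp (α * δ * τ))⁻¹ := by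
      rw [← Real.exp_neg]; congr 1; ring
    have e4 : √Real.pi * √Real.pi = Real.pi := Real.mul_self_sqrt Real.pi_pos.le
    rw [h, e2, e3, hC]
    have : √Real.pi / (α / 2) * (√Real.pi / (α * (δ * τ) / 2) * (Real.exp (α * δ * τ))⁻¹) =
        (√Real.pi * √Real.pi) * 4 / (α ^ 2 * (δ * τ)) * (Real.exp (α * δ * τ))⁻¹ := by
      field_simp
      ring
    rw [this, e4]
    have := Real.exp_pos (α * δ * τ)
    field_simp
  set D : ℝ := α * Real.exp (α * δ * τ) / (2 * Real.pi) with hD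
  have hDpos : 0 < D := by positivity
  have hterm : ∀ n : ℕ, D * logTerm α δ τ k₀ n =
      C * ((-1 : ℝ) ^ (n + 1) * k₀ ^ (2 * n) * ((α ^ 2 / 4) ^ n / (α ^ 2 / 4)) /
        (2 * ((n.factorial : ℝ) * (2 * (n:ℝ) - 1))) *
        ∫ t in Set.Ioi (0:ℝ), Real.exp (-t - α ^ 2 / 4 * (δ * τ) ^ 2 / t) * t ^ (-(n:ℝ) - 1)) := by
    intro n
    have hI : ∫ t in Set.Ioi (0:ℝ), Real.exp (-t - (α * δ * τ) ^ 2 / (4 * t)) *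
          t ^ (-(n:ℝ) - 1) =
        ∫ t in Set.Ioi (0:ℝ), Real.exp (-t - α ^ 2 / 4 * (δ * τ) ^ 2 / t) *
          t ^ (-(n:ℝ) - 1) := by
      congr 1; ext t
      congr 3
      by_cases ht : t = 0
      · simp [ht]
      · field_simp
    unfold logTerm besselKr
    rw [hI]
    generalize (∫ t in Set.Ioi (0:ℝ), Real.exp (-t - α ^ 2 / 4 * (δ * τ) ^ 2 / t) *
          t ^ (-(n:ℝ) - 1)) = I
    have h2 := two_sub_ne n
    rw [Real.rpow_natCast, Real.rpow_sub (by positivity), Real.rpow_one, Real.rpow_natCast]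
    have e : (α ^ 2 / 4) ^ n = (α * δ * τ / 2) ^ n / (2 * δ * τ / α) ^ n := by
      rw [← div_pow]; congr 1; field_simp; ring
    have hne : (2 * δ * τ / α) ^ n ≠ 0 := by positivity
    rw [e, hC, hD]
    generalize (2 * δ * τ / α) ^ n = u at *
    generalize (α * δ * τ / 2) ^ n = v at *
    field_simp
  have hs2 := hsc (hs.mul_left C) hterm
  have hsum : Summable (fun n : ℕ => logTerm α δ τ k₀ n) :=
    (summable_mul_left_iff hDpos.ne').1 hs2.summable
  refine ⟨hsum, ?_⟩
  rw [← tsum_mul_left, hs2.tsum_eq, hIntg]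
  congr 1
  linear_combination (k₀ / 2) * hK2
end

section
/- Mellin–Barnes representation of the asymmetric NIG density: let α > 0, β ∈ (−α, α−1) with β ≠ 0, δ > 0, μ ∈ ℝ, t > 0, and set γ := √(α²−β²). Then for every x ∈ ℝ with β(x−μt) < 0 and every c₁ > 0, c₂ > 0, f(x,t) = (α/(2π)) e^{γδt} · (1/(2π))² ∫_ℝ ∫_ℝ Γ((c₁+iu₁)/2) Γ(c₂+iu₂) · K_{1−(c₁+iu₁)/2}(αδt) · (2δt/α)^{(c₁+iu₁)/2} · |x−μt|^{−(c₁+iu₁)} · (−β(x−μt))^{−(c₂+iu₂)} du₁ du₂, i.e. f(x,t) equals (α/(2π)) e^{γδt} times the double Mellin–Barnes integral of Γ(s₁/2)Γ(s₂) K_{1−s₁/2}(αδt) (2δt/α)^{s₁/2} |x−μt|^{−s₁} (−β(x−μt))^{−s₂} ds₁ds₂/(2iπ)² over the vertical lines Re(s₁)=c₁, Re(s₂)=c₂. -/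
open MeasureTheory

/-- Asymmetric NIG density at time `t`. -/
noncomputable def nigDensityA (α β δ μ x t : ℝ) : ℝ :=
  (α * δ * t / Real.pi) * Real.exp (Real.sqrt (α ^ 2 - β ^ 2) * δ * t + β * (x - μ * t)) *
    besselKr 1 (α * Real.sqrt ((δ * t) ^ 2 + (x - μ * t) ^ 2)) /
    Real.sqrt ((δ * t) ^ 2 + (x - μ * t) ^ 2)

lemma gamma_norm_le (s : ℂ) (hs : 0 < s.re) : ‖Complex.Gamma s‖ ≤ Real.Gamma s.re := by
  rw [Complex.Gamma_eq_integral hs, Real.Gamma_eq_integral hs, Complex.GammaIntegral]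
  refine (norm_integral_le_integral_norm _).trans (le_of_eq ?_)
  refine setIntegral_congr_fun measurableSet_Ioi fun x hx => ?_
  have hx : 0 < x := hx
  simp only [norm_mul, Complex.norm_cpow_eq_rpow_re_of_pos hx, Complex.sub_re, Complex.one_re]
  rw [Complex.norm_real, Real.norm_of_nonneg (Real.exp_pos _).le]

lemma gamma_vert (c : ℝ) (hc : 0 < c) :
    Integrable (fun u : ℝ => Complex.Gamma ((c : ℂ) + (u : ℂ) * Complex.I)) := by
  have hcont : Continuous (fun u : ℝ => Complex.Gamma ((c : ℂ) + (u : ℂ) * Complex.I)) := by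
    rw [continuous_iff_continuousAt]
    intro u
    have h1 : ContinuousAt Complex.Gamma ((c : ℂ) + (u : ℂ) * Complex.I) := by
      refine (Complex.differentiableAt_Gamma _ fun m h => ?_).continuousAt
      have := congrArg Complex.re h
      simp at this
      have : (0 : ℝ) ≤ m := Nat.cast_nonneg m
      linarith
    exact ContinuousAt.comp (f := fun u : ℝ => (c : ℂ) + (u : ℂ) * Complex.I) h1 (by fun_prop)
  have hm : 0 < min (c ^ 2) 1 := lt_min (by positivity) one_pos
  refine (integrable_inv_one_add_sq.const_mul (Real.Gamma (c + 2) / min (c ^ 2) 1)).mono'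
    hcont.aestronglyMeasurable (Filter.Eventually.of_forall fun u => ?_)
  set s : ℂ := (c : ℂ) + (u : ℂ) * Complex.I with hs
  have hre : s.re = c := by simp [hs]
  have him : s.im = u := by simp [hs]
  have h0 : s ≠ 0 := fun h => by rw [h] at hre; simp at hre; linarith
  have h1 : s + 1 ≠ 0 := fun h => by
    have := congrArg Complex.re h
    simp [hre] at this; linarith
  have e1 := Complex.Gamma_add_one s h0
  have e2 := Complex.Gamma_add_one (s + 1) h1
  have hb := gamma_norm_le (s + 1 + 1) (by simp [hre]; linarith)
  rw [e2, e1, norm_mul, norm_mul] at hb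
  have hre2 : (s + 1 + 1).re = c + 2 := by simp [hre]; ring
  rw [hre2] at hb
  have n1 : ‖s‖ ^ 2 = c ^ 2 + u ^ 2 := by
    rw [Complex.sq_norm, Complex.normSq_apply, hre, him]; ring
  have n2 : ‖s + 1‖ ^ 2 = (c + 1) ^ 2 + u ^ 2 := by
    rw [Complex.sq_norm, Complex.normSq_apply]; simp [hre, him]; ring
  have n3 : ‖s‖ ≤ ‖s + 1‖ := by
    refine (sq_le_sq₀ (norm_nonneg _) (norm_nonneg _)).1 ?_
    rw [n1, n2]; nlinarith
  have n4 : min (c ^ 2) 1 * (1 + u ^ 2) ≤ ‖s + 1‖ * ‖s‖ := by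
    have a1 := min_le_left (c ^ 2) 1
    have a2 := min_le_right (c ^ 2) 1
    have : ‖s‖ * ‖s‖ ≤ ‖s + 1‖ * ‖s‖ := by gcongr
    nlinarith [mul_nonneg (sub_nonneg.2 a2) (sq_nonneg u)]
  have hu : 0 < 1 + u ^ 2 := by positivity
  rw [← div_eq_mul_inv, div_div, le_div_iff₀ (by positivity)]
  calc _ ≤ ‖Complex.Gamma s‖ * (‖s + 1‖ * ‖s‖) := by gcongr
    _ ≤ _ := by linarith

lemma gamma_inv (c : ℝ) (hc : 0 < c) (A : ℝ) (hA : 0 < A) :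
    ∫ u : ℝ, Complex.Gamma ((c : ℂ) + (u : ℂ) * Complex.I) *
      (A : ℂ) ^ (-((c : ℂ) + (u : ℂ) * Complex.I)) = 2 * Real.pi * Real.exp (-A) := by
  have hmel : ∀ s : ℂ, 0 < s.re → mellin (fun x : ℝ => ((Real.exp (-x) : ℝ) : ℂ)) s
      = Complex.Gamma s := fun s hs => by
    rw [Complex.Gamma_eq_integral hs, Complex.GammaIntegral_eq_mellin]
  have hre : ∀ u : ℝ, ((c : ℂ) + (u : ℂ) * Complex.I).re = c := by simp
  have key := mellinInv_mellin_eq c (fun x : ℝ => ((Real.exp (-x) : ℝ) : ℂ)) hA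
    (by
      have := Complex.GammaIntegral_convergent (s := (c : ℂ)) (by simpa using hc)
      refine this.congr_fun (fun x _ => ?_) measurableSet_Ioi
      exact mul_comm _ _)
    (by
      unfold Complex.VerticalIntegrable
      refine (gamma_vert c hc).congr (Filter.Eventually.of_forall fun u => ?_)
      exact (hmel _ (by rw [hre]; exact hc)).symm)
    (by fun_prop)
  rw [mellinInv] at key
  have h2 : ∀ u : ℝ, (A : ℂ) ^ (-((c : ℂ) + (u : ℂ) * Complex.I)) •
      mellin (fun x : ℝ => ((Real.exp (-x) : ℝ) : ℂ)) ((c : ℂ) + (u : ℂ) * Complex.I)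
      = Complex.Gamma ((c : ℂ) + (u : ℂ) * Complex.I) *
      (A : ℂ) ^ (-((c : ℂ) + (u : ℂ) * Complex.I)) := fun u => by
    rw [hmel _ (by rw [hre]; exact hc), smul_eq_mul, mul_comm]
  simp_rw [h2] at key
  rw [← key]
  have : (Real.pi : ℂ) ≠ 0 := by exact_mod_cast Real.pi_ne_zero
  generalize (∫ u : ℝ, Complex.Gamma ((c : ℂ) + (u : ℂ) * Complex.I) *
      (A : ℂ) ^ (-((c : ℂ) + (u : ℂ) * Complex.I))) = J
  simp only [Complex.real_smul]
  push_cast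
  field_simp

lemma cpow_exp (a : ℝ) (ha : 0 < a) (z : ℂ) :
    (a : ℂ) ^ z = Complex.exp ((Real.log a : ℂ) * z) := by
  rw [Complex.cpow_def_of_ne_zero (by exact_mod_cast ha.ne'), Complex.ofReal_log ha.le]

lemma gamma_half (c : ℝ) (hc : 0 < c) :
    Integrable (fun u : ℝ => Complex.Gamma (((c : ℂ) + (u : ℂ) * Complex.I) / 2)) := by
  have := (gamma_vert (c / 2) (by positivity)).comp_div (two_ne_zero (α := ℝ))
  refine this.congr (Filter.Eventually.of_forall fun u => ?_)
  simp only []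
  congr 1
  push_cast
  ring

lemma gamma_half_inv (c : ℝ) (hc : 0 < c) (A : ℝ) (hA : 0 < A) :
    ∫ u : ℝ, Complex.Gamma (((c : ℂ) + (u : ℂ) * Complex.I) / 2) *
      Complex.exp ((Real.log A : ℂ) * (-(((c : ℂ) + (u : ℂ) * Complex.I) / 2)))
      = 4 * Real.pi * Real.exp (-A) := by
  have h := Measure.integral_comp_div (fun u : ℝ =>
    Complex.Gamma (((c / 2 : ℝ) : ℂ) + (u : ℂ) * Complex.I) *
      (A : ℂ) ^ (-(((c / 2 : ℝ) : ℂ) + (u : ℂ) * Complex.I))) 2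
  rw [gamma_inv (c / 2) (by positivity) A hA] at h
  have e : ∀ u : ℝ, (((c / 2 : ℝ) : ℂ) + ((u / 2 : ℝ) : ℂ) * Complex.I)
      = ((c : ℂ) + (u : ℂ) * Complex.I) / 2 := fun u => by push_cast; ring
  simp_rw [e, cpow_exp A hA] at h
  rw [h]
  simp
  ring

lemma h_int (c b C : ℝ) (hc : 0 < c) (hb : 0 < b) (hC : 0 < C) :
    IntegrableOn (fun τ : ℝ => Real.exp (Real.log (C / τ) * (-(c / 2))) *
      (Real.exp (-τ - b / τ) * (τ ^ 2)⁻¹)) (Set.Ioi 0) := by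
  have h := (Real.GammaIntegral_convergent (s := c / 2 + 1) (by positivity)).const_mul
    (Real.exp (Real.log C * (-(c / 2))) * (2 / b ^ 2))
  refine Integrable.mono' h (by fun_prop) ?_
  filter_upwards [ae_restrict_mem measurableSet_Ioi] with τ hτ
  have hτ : 0 < τ := hτ
  rw [Real.norm_of_nonneg (by positivity), Real.log_div hC.ne' hτ.ne']
  have e1 : Real.exp ((Real.log C - Real.log τ) * (-(c / 2)))
      = Real.exp (Real.log C * (-(c / 2))) * τ ^ (c / 2 + 1 - 1) := by
    rw [Real.rpow_def_of_pos hτ, ← Real.exp_add]; ring_nf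
  have e2 : Real.exp (-τ - b / τ) * (τ ^ 2)⁻¹ ≤ 2 / b ^ 2 * Real.exp (-τ) := by
    have q := Real.quadratic_le_exp_of_nonneg (x := b / τ) (by positivity)
    have q2 : (b / τ) ^ 2 / 2 ≤ Real.exp (b / τ) := by
      have : 0 < b / τ := by positivity
      linarith
    rw [sub_eq_add_neg, Real.exp_add, Real.exp_neg (b / τ)]
    have : (Real.exp (b / τ))⁻¹ * (τ ^ 2)⁻¹ ≤ 2 / b ^ 2 := by
      rw [← mul_inv, inv_le_comm₀ (by positivity) (by positivity)]
      calc (2 / b ^ 2)⁻¹ = (b / τ) ^ 2 / 2 * τ ^ 2 := by field_simp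
        _ ≤ _ := by gcongr
    calc _ = Real.exp (-τ) * ((Real.exp (b / τ))⁻¹ * (τ ^ 2)⁻¹) := by ring
      _ ≤ Real.exp (-τ) * (2 / b ^ 2) := by gcongr
      _ = _ := by ring
  rw [e1]
  calc _ ≤ Real.exp (Real.log C * (-(c / 2))) * τ ^ (c / 2 + 1 - 1) *
        (2 / b ^ 2 * Real.exp (-τ)) := by gcongr
    _ = _ := by ring

lemma pow_id (α D y τ : ℝ) (hα : 0 < α) (hD : 0 < D) (hy : 0 < y) (hτ : 0 < τ) (w : ℂ) :
    (((α * D : ℝ) : ℂ) / 2) ^ (1 - w) * (τ : ℂ) ^ (-(1 - w) - 1) *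
      ((2 * D / α : ℝ) : ℂ) ^ w * (y : ℂ) ^ (-(2 * w))
    = ((α * D / 2 : ℝ) : ℂ) * (((τ ^ 2)⁻¹ : ℝ) : ℂ) *
      Complex.exp ((Real.log (α ^ 2 * y ^ 2 / 4 / τ) : ℂ) * (-w)) := by
  have h1 : ((α * D : ℝ) : ℂ) / 2 = ((α * D / 2 : ℝ) : ℂ) := by push_cast; ring
  have h2 : ((α * D / 2 : ℝ) : ℂ) = Complex.exp (Real.log (α * D / 2) : ℂ) := by
    rw [← Complex.ofReal_exp, Real.exp_log (by positivity)]
  have h3 : (((τ ^ 2)⁻¹ : ℝ) : ℂ) = Complex.exp ((-(2 * Real.log τ) : ℝ) : ℂ) := by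
    rw [← Complex.ofReal_exp, Real.exp_neg, two_mul, Real.exp_add, Real.exp_log hτ, sq]
  rw [h1, cpow_exp _ (by positivity), cpow_exp _ hτ, cpow_exp _ (by positivity), cpow_exp _ hy,
    h2, h3]
  simp only [← Complex.exp_add]
  congr 1
  have l2 : Real.log 4 = 2 * Real.log 2 := by
    rw [show (4 : ℝ) = 2 ^ 2 by norm_num, Real.log_pow]; norm_num
  rw [Real.log_div (by positivity) (by positivity), Real.log_mul (by positivity) (by positivity),
    Real.log_div (by positivity) (by positivity), Real.log_mul (by positivity) (by positivity),
    Real.log_div (by positivity) (by positivity), Real.log_div (by positivity) (by positivity),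
    Real.log_mul (by positivity) (by positivity), Real.log_pow, Real.log_pow, l2]
  push_cast
  ring

lemma first_int (α D y c : ℝ) (hα : 0 < α) (hD : 0 < D) (hy : 0 < y) (hc : 0 < c) :
    ∫ u : ℝ, Complex.Gamma (((c : ℂ) + (u : ℂ) * Complex.I) / 2) *
      besselK (1 - ((c : ℂ) + (u : ℂ) * Complex.I) / 2) (α * D) *
      ((2 * D / α : ℝ) : ℂ) ^ (((c : ℂ) + (u : ℂ) * Complex.I) / 2) *
      (y : ℂ) ^ (-((c : ℂ) + (u : ℂ) * Complex.I))
    = ((4 * Real.pi * D * besselKr 1 (α * Real.sqrt (D ^ 2 + y ^ 2)) /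
        Real.sqrt (D ^ 2 + y ^ 2) : ℝ) : ℂ) := by
  set C := α ^ 2 * y ^ 2 / 4 with hC
  have hCpos : 0 < C := by positivity
  set b := (α * D) ^ 2 / 4 with hb
  have hbpos : 0 < b := by positivity
  let f : ℝ → ℝ → ℂ := fun u τ => Complex.Gamma (((c : ℂ) + (u : ℂ) * Complex.I) / 2) *
      (Complex.exp ((Real.log (C / τ) : ℂ) * (-(((c : ℂ) + (u : ℂ) * Complex.I) / 2))) *
        ((Real.exp (-τ - b / τ) * (τ ^ 2)⁻¹ : ℝ) : ℂ))
  have step1 : ∀ u : ℝ, Complex.Gamma (((c : ℂ) + (u : ℂ) * Complex.I) / 2) *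
      besselK (1 - ((c : ℂ) + (u : ℂ) * Complex.I) / 2) (α * D) *
      ((2 * D / α : ℝ) : ℂ) ^ (((c : ℂ) + (u : ℂ) * Complex.I) / 2) *
      (y : ℂ) ^ (-((c : ℂ) + (u : ℂ) * Complex.I))
      = ((α * D / 4 : ℝ) : ℂ) * ∫ τ in Set.Ioi (0 : ℝ), f u τ := by
    intro u
    set w : ℂ := ((c : ℂ) + (u : ℂ) * Complex.I) / 2 with hw
    have hw2 : (c : ℂ) + (u : ℂ) * Complex.I = 2 * w := by rw [hw]; ring
    rw [hw2, besselK]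
    have r : ∀ (G a I1 p q : ℂ), G * (1 / 2 * a * I1) * p * q = (G * (1 / 2) * a * p * q) * I1 :=
      fun G a I1 p q => by ring
    rw [r, ← integral_const_mul, ← integral_const_mul]
    refine setIntegral_congr_fun measurableSet_Ioi fun τ hτ => ?_
    have hτ : 0 < τ := hτ
    have key := pow_id α D y τ hα hD hy hτ w
    have he : Complex.exp (-(τ : ℂ) - ((α * D : ℝ) : ℂ) ^ 2 / (4 * (τ : ℂ)))
        = ((Real.exp (-τ - b / τ) : ℝ) : ℂ) := by
      rw [Complex.ofReal_exp]
      congr 1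
      rw [hb]
      push_cast
      rw [div_div]
    simp only [f]
    rw [he, ← hw]
    push_cast at key ⊢
    linear_combination (Complex.Gamma w * (1 / 2) * Complex.exp (-(τ : ℂ) - b / τ)) * key
  simp_rw [step1]
  rw [integral_const_mul, integral_integral_swap]
  · have step2 : ∀ τ ∈ Set.Ioi (0 : ℝ), (∫ u : ℝ, f u τ) = ((4 * Real.pi *
        (Real.exp (-τ - (α * Real.sqrt (D ^ 2 + y ^ 2)) ^ 2 / (4 * τ)) * τ ^ (-1 - 1 : ℝ)) : ℝ) : ℂ) := by
      intro τ hτ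
      have hτ : 0 < τ := hτ
      simp only [f, ← mul_assoc]
      rw [integral_mul_const, gamma_half_inv c hc (C / τ) (by positivity)]
      have e1 : τ ^ (-1 - 1 : ℝ) = (τ ^ 2)⁻¹ := by
        rw [show (-1 - 1 : ℝ) = -((2 : ℕ) : ℝ) by norm_num, Real.rpow_neg hτ.le, Real.rpow_natCast]
      have e2 : Real.exp (-τ - (α * Real.sqrt (D ^ 2 + y ^ 2)) ^ 2 / (4 * τ))
          = Real.exp (-(C / τ)) * Real.exp (-τ - b / τ) := by
        rw [← Real.exp_add, mul_pow, Real.sq_sqrt (by positivity), hC, hb]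
        congr 1
        field_simp
        ring
      rw [e1, e2]
      push_cast
      ring
    rw [setIntegral_congr_fun measurableSet_Ioi step2, integral_complex_ofReal, ← Complex.ofReal_mul,
      integral_const_mul, besselKr]
    congr 1
    have hR : 0 < Real.sqrt (D ^ 2 + y ^ 2) := by positivity
    rw [Real.rpow_one]
    field_simp
    norm_num
    ring
  · have hg := (gamma_half c hc).norm.mul_prod (h_int c b C hc hbpos hCpos)
    refine hg.mono' ?_ (Filter.Eventually.of_forall ?_)
    · have hG : AEStronglyMeasurable (fun p : ℝ × ℝ =>
          Complex.Gamma (((c : ℂ) + (p.1 : ℂ) * Complex.I) / 2))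
          ((volume : Measure ℝ).prod (volume.restrict (Set.Ioi 0))) :=
        (gamma_half c hc).aestronglyMeasurable.comp_fst
      refine hG.mul (Measurable.aestronglyMeasurable ?_)
      fun_prop
    · rintro ⟨u, τ⟩
      simp only [Function.uncurry, f, norm_mul, Complex.norm_exp, Complex.norm_real]
      refine le_of_eq ?_
      congr 1
      congr 1
      · congr 1
        simp
      · simp

/-- Mellin–Barnes representation of the asymmetric NIG density. -/
theorem asym_nig_density_mellin_barnes
    (α β δ μ t : ℝ) (hα : 0 < α) (hβl : -α < β) (hβu : β < α - 1) (hβ : β ≠ 0)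
    (hδ : 0 < δ) (ht : 0 < t)
    (x : ℝ) (hx : β * (x - μ * t) < 0)
    (c₁ c₂ : ℝ) (hc₁ : 0 < c₁) (hc₂ : 0 < c₂) :
    (nigDensityA α β δ μ x t : ℂ) =
      ((α / (2 * Real.pi) * Real.exp (Real.sqrt (α ^ 2 - β ^ 2) * δ * t) : ℝ) : ℂ) *
        (((1 / (2 * Real.pi)) ^ 2 : ℝ) : ℂ) *
        ∫ u₁ : ℝ, ∫ u₂ : ℝ,
          Complex.Gamma (((c₁ : ℂ) + (u₁ : ℂ) * Complex.I) / 2) *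
            Complex.Gamma ((c₂ : ℂ) + (u₂ : ℂ) * Complex.I) *
            besselK (1 - ((c₁ : ℂ) + (u₁ : ℂ) * Complex.I) / 2) (α * δ * t) *
            ((2 * δ * t / α : ℝ) : ℂ) ^ (((c₁ : ℂ) + (u₁ : ℂ) * Complex.I) / 2) *
            ((|x - μ * t| : ℝ) : ℂ) ^ (-((c₁ : ℂ) + (u₁ : ℂ) * Complex.I)) *
            ((-(β * (x - μ * t)) : ℝ) : ℂ) ^ (-((c₂ : ℂ) + (u₂ : ℂ) * Complex.I)) := by

  have hw : x - μ * t ≠ 0 := fun h => by rw [h] at hx; simp at hx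
  have hD : 0 < δ * t := mul_pos hδ ht
  have h1 := first_int α (δ * t) |x - μ * t| c₁ hα hD (abs_pos.2 hw) hc₁
  have h2 := gamma_inv c₂ hc₂ (-(β * (x - μ * t))) (by linarith)
  rw [sq_abs] at h1
  have e : ∀ u₁ u₂ : ℝ, Complex.Gamma (((c₁ : ℂ) + (u₁ : ℂ) * Complex.I) / 2) *
            Complex.Gamma ((c₂ : ℂ) + (u₂ : ℂ) * Complex.I) *
            besselK (1 - ((c₁ : ℂ) + (u₁ : ℂ) * Complex.I) / 2) (α * δ * t) *
            ((2 * δ * t / α : ℝ) : ℂ) ^ (((c₁ : ℂ) + (u₁ : ℂ) * Complex.I) / 2) *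
            ((|x - μ * t| : ℝ) : ℂ) ^ (-((c₁ : ℂ) + (u₁ : ℂ) * Complex.I)) *
            ((-(β * (x - μ * t)) : ℝ) : ℂ) ^ (-((c₂ : ℂ) + (u₂ : ℂ) * Complex.I))
      = (Complex.Gamma (((c₁ : ℂ) + (u₁ : ℂ) * Complex.I) / 2) *
          besselK (1 - ((c₁ : ℂ) + (u₁ : ℂ) * Complex.I) / 2) (α * (δ * t)) *
          ((2 * (δ * t) / α : ℝ) : ℂ) ^ (((c₁ : ℂ) + (u₁ : ℂ) * Complex.I) / 2) *
          ((|x - μ * t| : ℝ) : ℂ) ^ (-((c₁ : ℂ) + (u₁ : ℂ) * Complex.I))) *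
        (Complex.Gamma ((c₂ : ℂ) + (u₂ : ℂ) * Complex.I) *
          ((-(β * (x - μ * t)) : ℝ) : ℂ) ^ (-((c₂ : ℂ) + (u₂ : ℂ) * Complex.I))) := by
    intro u₁ u₂
    rw [mul_assoc α δ t, mul_assoc 2 δ t]
    ring
  simp_rw [e, integral_const_mul, integral_mul_const]
  rw [h1, h2, nigDensityA, Real.exp_add, neg_neg]
  have hp : (Real.pi : ℂ) ≠ 0 := by exact_mod_cast Real.pi_ne_zero
  have hR : ((Real.sqrt ((δ * t) ^ 2 + (x - μ * t) ^ 2) : ℝ) : ℂ) ≠ 0 := by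
    have : 0 < Real.sqrt ((δ * t) ^ 2 + (x - μ * t) ^ 2) := by positivity
    exact_mod_cast this.ne'
  generalize Real.sqrt ((δ * t) ^ 2 + (x - μ * t) ^ 2) = R at *
  generalize besselKr 1 (α * R) = K
  generalize Real.exp (Real.sqrt (α ^ 2 - β ^ 2) * δ * t) = E1
  generalize Real.exp (β * (x - μ * t)) = E2
  push_cast
  field_simp
  try ring
end
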